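/- Fix x₀ ∈ ℝ and ρ > 0, and let Ω = ℝ × (0, ρ). Define g, f : Ω → ℝ by g(x,y) = x − x₀ − √(ρ² − y²) and f(x,y) = −x/ρ + √(1 − (y/ρ)²) − artanh(√(1 − (y/ρ)²)). Then at every point of Ω: (i) ∇f·∇g = 0, and (ii) ‖∇f(x,y)‖ = 1/y. -/

import Mathlib

open Set

/-- Euclidean norm of a vector in `ℝ × ℝ`. -/
noncomputable def elen (v : ℝ × ℝ) : ℝ := Real.sqrt (v.1 ^ 2 + v.2 ^ 2)

/-- Euclidean dot product on `ℝ × ℝ`. -/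
def dotp (v w : ℝ × ℝ) : ℝ := v.1 * w.1 + v.2 * w.2

/-- The gradient `(u_x, u_y)` of `u : ℝ × ℝ → ℝ` at a point. -/
noncomputable def grad (u : ℝ × ℝ → ℝ) (p : ℝ × ℝ) : ℝ × ℝ :=
  (fderiv ℝ u p (1, 0), fderiv ℝ u p (0, 1))

/-- Real inverse hyperbolic tangent: `artanh s = (1/2)·ln((1+s)/(1−s))`. -/
noncomputable def artanh (s : ℝ) : ℝ := (1 / 2) * Real.log ((1 + s) / (1 - s))

theorem grad_aux (u : ℝ × ℝ → ℝ) (a : ℝ) (h : ℝ → ℝ) (h' : ℝ) (p : ℝ × ℝ)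
    (hu : ∀ w, u w = a * w.1 + h w.2) (hh : HasDerivAt h h' p.2) :
    grad u p = (a, h') := by
  have e : u = fun w => a * w.1 + h w.2 := funext hu
  have h1 : HasFDerivAt (fun w : ℝ × ℝ => a * w.1) (a • ContinuousLinearMap.fst ℝ ℝ ℝ) p :=
    (hasFDerivAt_fst (𝕜 := ℝ) (p := p)).const_mul a
  have h2 : HasFDerivAt (fun w : ℝ × ℝ => h w.2) (h' • ContinuousLinearMap.snd ℝ ℝ ℝ) p :=
    hh.comp_hasFDerivAt p (hasFDerivAt_snd (𝕜 := ℝ) (p := p))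
  have h3 : fderiv ℝ u p = a • ContinuousLinearMap.fst ℝ ℝ ℝ + h' • ContinuousLinearMap.snd ℝ ℝ ℝ := by
    rw [e]
    exact (h1.add h2).fderiv
  unfold grad
  rw [h3]
  simp

/-- the calibration pair for the hyperbolic density `1/y`.
On `Ω = ℝ × (0, ρ)`, with `g(x,y) = x − x₀ − √(ρ² − y²)` and
`f(x,y) = −x/ρ + √(1 − (y/ρ)²) − artanh(√(1 − (y/ρ)²))`,
one has `∇f·∇g = 0` and `‖∇f‖ = 1/y`. -/
theorem statement11 (x₀ ρ : ℝ) (hρ : 0 < ρ) (p : ℝ × ℝ)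
    (hp : p ∈ (univ : Set ℝ) ×ˢ Ioo 0 ρ) :
    dotp (grad (fun w : ℝ × ℝ => -w.1 / ρ + Real.sqrt (1 - (w.2 / ρ) ^ 2)
            - artanh (Real.sqrt (1 - (w.2 / ρ) ^ 2))) p)
        (grad (fun w : ℝ × ℝ => w.1 - x₀ - Real.sqrt (ρ ^ 2 - w.2 ^ 2)) p) = 0 ∧
    elen (grad (fun w : ℝ × ℝ => -w.1 / ρ + Real.sqrt (1 - (w.2 / ρ) ^ 2)
            - artanh (Real.sqrt (1 - (w.2 / ρ) ^ 2))) p)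
      = 1 / p.2 := by
  obtain ⟨x, y⟩ := p
  have hy : 0 < y := hp.2.1
  have hyr : y < ρ := hp.2.2
  have hd : 0 < 1 - (y / ρ) ^ 2 := by
    have h1 : y / ρ < 1 := (div_lt_one hρ).2 hyr
    have h0 : 0 < y / ρ := div_pos hy hρ
    nlinarith
  set s := Real.sqrt (1 - (y / ρ) ^ 2) with hs
  have hs0 : 0 < s := Real.sqrt_pos.2 hd
  have hs2 : s ^ 2 = 1 - (y / ρ) ^ 2 := Real.sq_sqrt hd.le
  have hs1 : s < 1 := by
    have h0 : 0 < y / ρ := div_pos hy hρ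
    nlinarith
  have hS : Real.sqrt (ρ ^ 2 - y ^ 2) = ρ * s := by
    rw [Real.sqrt_eq_iff_mul_self_eq_of_pos (by positivity)]
    have : ρ * s * (ρ * s) = ρ ^ 2 * s ^ 2 := by ring
    rw [this, hs2]
    field_simp
  have hS0 : ρ ^ 2 - y ^ 2 ≠ 0 := by nlinarith
  have hsd : HasDerivAt (fun t : ℝ => Real.sqrt (1 - (t / ρ) ^ 2)) (-y / (ρ ^ 2 * s)) y := by
    have h := ((((hasDerivAt_id y).div_const ρ).pow 2).const_sub 1).sqrt hd.ne'
    refine HasDerivAt.congr_deriv h ?_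
    simp only [id, Pi.pow_apply]
    rw [← hs]
    field_simp
    norm_num
    field_simp
  have hart : HasDerivAt artanh (1 / (1 - s ^ 2)) s := by
    have hn : (1 - s) ≠ 0 := by linarith
    have hn' : (1 + s) ≠ 0 := by linarith
    have hn2 : 1 - s ^ 2 ≠ 0 := by nlinarith
    have h := ((((hasDerivAt_id s).const_add 1).div ((hasDerivAt_id s).const_sub 1) hn).log
      (div_ne_zero hn' hn)).const_mul (1 / 2)
    refine HasDerivAt.congr_deriv h ?_
    simp only [id, Pi.div_apply]
    have : 1 - s ^ 2 = (1 - s) * (1 + s) := by ring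
    rw [this]
    field_simp
    ring
  have hF : HasDerivAt (fun t : ℝ => Real.sqrt (1 - (t / ρ) ^ 2)
      - artanh (Real.sqrt (1 - (t / ρ) ^ 2))) (s / y) y := by
    have h := hsd.sub (HasDerivAt.comp y hart hsd)
    refine HasDerivAt.congr_deriv h ?_
    have : 1 - s ^ 2 = (y / ρ) ^ 2 := by rw [hs2]; ring
    rw [this]
    have e : ρ ^ 2 * s ^ 2 = ρ ^ 2 - y ^ 2 := by rw [hs2]; field_simp
    field_simp
    linarith
  have hG : HasDerivAt (fun t : ℝ => - x₀ - Real.sqrt (ρ ^ 2 - t ^ 2)) (y / (ρ * s)) y := by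
    have h := ((((hasDerivAt_id y).pow 2).const_sub (ρ ^ 2)).sqrt hS0).const_sub (-x₀)
    refine HasDerivAt.congr_deriv h ?_
    simp only [id, Pi.pow_apply, hS]
    field_simp
    norm_num
  rw [grad_aux _ (-1 / ρ) _ _ (x, y) (fun w => by ring) hF,
    grad_aux _ 1 _ _ (x, y) (fun w => by ring) hG]
  constructor
  · simp only [dotp]
    field_simp
    norm_num
  · simp only [elen]
    have : (-1 / ρ) ^ 2 + (s / y) ^ 2 = (1 / y) ^ 2 := by
      rw [div_pow s, hs2]
      field_simp
      ring
    rw [this, Real.sqrt_sq (by positivity)]
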